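/- arXiv:2311.09095 — 2 statements merged into one kernel-verified Lean document; each statement's English description precedes it below -/
import Mathlib

section
/- Let X, Y, Z be finite nonempty sets, let A ∈ {0,1}^{X×Y}, B ∈ {0,1}^{Y×Z} and C ∈ {0,1}^{X×Z}, and set ε = 1/160. Let d ≥ 320 and assume: A and B^T are both (ε,2,d)-regular and ε-min-degree; E[A] > 0; E[B] > 0; and E[C] > 2^{−εd/2}. Then there exists a triangle, i.e., a triple (x,y,z) ∈ X×Y×Z with A(x,y) = B(y,z) = C(x,z) = 1. -/
open Finset

/-- The density `E[A]` of a matrix restricted to the rectangle `Sx × Sy`. -/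
noncomputable def density {X Y : Type*} (Sx : Finset X) (Sy : Finset Y) (A : X → Y → ℝ) : ℝ :=
  (∑ x ∈ Sx, ∑ y ∈ Sy, A x y) / ((Sx.card : ℝ) * (Sy.card : ℝ))

/-- The (relative) degree `deg_A(x)` of a row `x`, with columns restricted to `Sy`. -/
noncomputable def rowDeg {X Y : Type*} (Sy : Finset Y) (A : X → Y → ℝ) (x : X) : ℝ :=
  (∑ y ∈ Sy, A x y) / (Sy.card : ℝ)

/-- The `(k,ℓ)`-grid norm `‖A‖_{U(k,ℓ)}` of a matrix restricted to the rectangle `Sx × Sy`: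
the `(kℓ)`-th root of the average of `∏_{i,j} A(x_i, y_j)` over all tuples
`x_1, …, x_k ∈ Sx`, `y_1, …, y_ℓ ∈ Sy`. -/
noncomputable def gridNorm {X Y : Type*} (Sx : Finset X) (Sy : Finset Y) (k l : ℕ)
    (A : X → Y → ℝ) : ℝ :=
  ((∑ xs ∈ Fintype.piFinset (fun _ : Fin k => Sx),
      ∑ ys ∈ Fintype.piFinset (fun _ : Fin l => Sy),
      ∏ i : Fin k, ∏ j : Fin l, A (xs i) (ys j)) /
    ((Sx.card : ℝ) ^ k * (Sy.card : ℝ) ^ l)) ^ ((1 : ℝ) / (k * l))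

/-- `A` (restricted to `Sx × Sy`) is `(ε,k,ℓ)`-regular if `‖A‖_{U(k,ℓ)} ≤ (1+ε)·E[A]`. -/
def GridRegular {X Y : Type*} (Sx : Finset X) (Sy : Finset Y) (ε : ℝ) (k l : ℕ)
    (A : X → Y → ℝ) : Prop :=
  gridNorm Sx Sy k l A ≤ (1 + ε) * density Sx Sy A

/-- `A` (restricted to `Sx × Sy`) is `ε`-min-degree if every row has degree
at least `(1-ε)·E[A]`. -/
def MinDegree {X Y : Type*} (Sx : Finset X) (Sy : Finset Y) (ε : ℝ) (A : X → Y → ℝ) : Prop :=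
  ∀ x ∈ Sx, (1 - ε) * density Sx Sy A ≤ rowDeg Sy A x

/-- `A` is a zero-one matrix on the rectangle `Sx × Sy`. -/
def ZeroOne {X Y : Type*} (Sx : Finset X) (Sy : Finset Y) (A : X → Y → ℝ) : Prop :=
  ∀ x ∈ Sx, ∀ y ∈ Sy, A x y = 0 ∨ A x y = 1

open scoped BigOperators

/-- Expanding the `k`-th moment of the correlation of the rows of `f` with those of `g`. -/
lemma expect_correlation_pow {X Y Z : Type*} [Fintype X] [Fintype Y] [Fintype Z]
    (f : X → Y → ℝ) (g : Z → Y → ℝ) (k : ℕ) :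
    𝔼 x, 𝔼 z, (𝔼 y, f x y * g z y) ^ k =
      𝔼 p ∈ Fintype.piFinset fun _ : Fin k => (univ : Finset Y),
        (𝔼 x, ∏ i, f x (p i)) * 𝔼 z, ∏ i, g z (p i) := by
  simp_rw [Finset.expect_pow, prod_mul_distrib, Finset.expect_mul_expect]
  exact (expect_congr rfl fun x _ => expect_comm univ _ _).trans (expect_comm univ _ _)

lemma expect_one_add_pow {U V : Type*} [Fintype U] [Fintype V] (h : U → V → ℝ) (d : ℕ) :
    𝔼 u, 𝔼 v, (1 + h u v) ^ d =
      ∑ k ∈ range (d + 1), (𝔼 u, 𝔼 v, h u v ^ k) * (d.choose k : ℝ) := by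
  simp_rw [add_comm (1 : ℝ), add_pow, one_pow, mul_one, expect_sum_comm, ← expect_mul]

/-- Decoupling: the shifted correlation moments of `f` with `g` are at most the average of those of
`f` with `f` and of `g` with `g`. -/
lemma expect_one_add_correlation_pow_le {X Y Z : Type*} [Fintype X] [Fintype Y] [Fintype Z]
    (f : X → Y → ℝ) (g : Z → Y → ℝ) (d : ℕ) :
    𝔼 x, 𝔼 z, (1 + 𝔼 y, f x y * g z y) ^ d ≤
      ((𝔼 x, 𝔼 x', (1 + 𝔼 y, f x y * f x' y) ^ d) +
        𝔼 z, 𝔼 z', (1 + 𝔼 y, g z y * g z' y) ^ d) / 2 := by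
  have moment (k : ℕ) : 𝔼 x, 𝔼 z, (𝔼 y, f x y * g z y) ^ k ≤
      ((𝔼 x, 𝔼 x', (𝔼 y, f x y * f x' y) ^ k) + 𝔼 z, 𝔼 z', (𝔼 y, g z y * g z' y) ^ k) / 2 := by
    simp_rw [expect_correlation_pow]
    rw [← expect_add_distrib, expect_div]
    exact expect_le_expect fun p _ => by
      nlinarith [sq_nonneg ((𝔼 x, ∏ i, f x (p i)) - 𝔼 z, ∏ i, g z (p i))]
  rw [expect_one_add_pow, expect_one_add_pow, expect_one_add_pow, ← sum_add_distrib, sum_div]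
  refine sum_le_sum fun k _ => ?_
  rw [← add_mul, mul_div_right_comm]
  exact mul_le_mul_of_nonneg_right (moment k) (by positivity)

lemma density_univ_eq_expect {X Y : Type*} [Fintype X] [Fintype Y] (A : X → Y → ℝ) :
    density univ univ A = 𝔼 x, 𝔼 y, A x y := by
  simp_rw [density, expect_eq_sum_div_card, ← sum_div, div_div, mul_comm]

lemma rowDeg_univ_eq_expect {X Y : Type*} [Fintype Y] (A : X → Y → ℝ) (x : X) :
    rowDeg univ A x = 𝔼 y, A x y := by
  rw [rowDeg, expect_eq_sum_div_card]

lemma gridNorm_two_pow {X Y : Type*} [Fintype X] [Fintype Y] (A : X → Y → ℝ)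
    (hA : ∀ x y, 0 ≤ A x y) {d : ℕ} (hd : d ≠ 0) :
    gridNorm univ univ 2 d A ^ (2 * d) = 𝔼 x, 𝔼 x', (𝔼 y, A x y * A x' y) ^ d := by
  rw [gridNorm, ← Real.rpow_natCast, ← Real.rpow_mul]
  · have h : (1 : ℝ) / ((2 : ℕ) * d) * ((2 * d : ℕ) : ℝ) = 1 := by
      push_cast; field_simp
    rw [h, Real.rpow_one]
    simp_rw [Finset.expect_pow, expect_eq_sum_div_card, Fintype.card_piFinset_const, ← sum_div,
      div_div, Fintype.piFinset_univ, Fin.prod_univ_two, ← prod_mul_distrib]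
    rw [← (finTwoArrowEquiv X).symm.sum_comp, Fintype.sum_prod_type]
    congr 1
    simp only [card_univ, Nat.cast_pow]
    ring
  · refine div_nonneg (sum_nonneg fun _ _ => sum_nonneg fun _ _ => prod_nonneg fun _ _ =>
      prod_nonneg fun _ _ => hA _ _) (by positivity)

/-- The correlation of two rows after normalizing each to mean one and subtracting that mean. -/
lemma one_add_expect_normalized {X Y Z : Type*} [Fintype Y] [Nonempty Y]
    (A : X → Y → ℝ) (B : Z → Y → ℝ) {x : X} {z : Z}
    (hx : rowDeg univ A x ≠ 0) (hz : rowDeg univ B z ≠ 0) :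
    1 + 𝔼 y, (A x y / rowDeg univ A x - 1) * (B z y / rowDeg univ B z - 1) =
      (𝔼 y, A x y * B z y) / (rowDeg univ A x * rowDeg univ B z) := by
  have h (y : Y) : (A x y / rowDeg univ A x - 1) * (B z y / rowDeg univ B z - 1) =
      A x y * B z y / (rowDeg univ A x * rowDeg univ B z) - A x y / rowDeg univ A x
        - B z y / rowDeg univ B z + 1 := by
    field_simp; ring
  simp_rw [h, expect_add_distrib, expect_sub_distrib, ← expect_div, ← rowDeg_univ_eq_expect,
    div_self hx, div_self hz]
  rw [expect_const univ_nonempty]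
  ring

lemma MinDegree.rowDeg_pos {X Y : Type*} [Fintype X] [Fintype Y] {A : X → Y → ℝ} {ε : ℝ}
    (hε : ε < 1) (h : MinDegree univ univ ε A) (hd : 0 < density univ univ A) (x : X) :
    0 < rowDeg univ A x :=
  (mul_pos (sub_pos.2 hε) hd).trans_le (h x (mem_univ x))

/-- A regular matrix of large minimum degree has small normalized self-correlation moments. -/
lemma GridRegular.expect_normalized_le {X Y : Type*} [Fintype X] [Fintype Y] [Nonempty Y]
    {A : X → Y → ℝ} {ε : ℝ} {d : ℕ} (hA : ∀ x y, 0 ≤ A x y) (hε : ε < 1) (hd : d ≠ 0)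
    (hreg : GridRegular univ univ ε 2 d A) (hmin : MinDegree univ univ ε A)
    (hpos : 0 < density univ univ A) :
    𝔼 x, 𝔼 x', (1 + 𝔼 y, (A x y / rowDeg univ A x - 1) * (A x' y / rowDeg univ A x' - 1)) ^ d ≤
      (((1 + ε) / (1 - ε)) ^ 2) ^ d := by
  have hδ : 0 < (1 - ε) * density univ univ A := mul_pos (sub_pos.2 hε) hpos
  have hdeg := hmin.rowDeg_pos hε hpos
  calc
    _ ≤ 𝔼 x, 𝔼 x', (𝔼 y, A x y * A x' y) ^ d / ((1 - ε) * density univ univ A) ^ (2 * d) := by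
      refine expect_le_expect fun x _ => expect_le_expect fun x' _ => ?_
      rw [one_add_expect_normalized A A (hdeg x).ne' (hdeg x').ne', pow_mul, ← div_pow]
      have hnn : 0 ≤ 𝔼 y, A x y * A x' y := expect_nonneg fun y _ => mul_nonneg (hA x y) (hA x' y)
      refine pow_le_pow_left₀ (div_nonneg hnn (mul_pos (hdeg x) (hdeg x')).le) ?_ d
      rw [sq]
      exact div_le_div_of_nonneg_left hnn (mul_pos hδ hδ)
        (mul_le_mul (hmin x (mem_univ x)) (hmin x' (mem_univ x')) hδ.le (hdeg x).le)
    _ = (gridNorm univ univ 2 d A / ((1 - ε) * density univ univ A)) ^ (2 * d) := by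
      simp_rw [← expect_div]
      rw [← gridNorm_two_pow A hA hd, div_pow]
    _ ≤ ((1 + ε) / (1 - ε)) ^ (2 * d) := by
      have hnn : 0 ≤ gridNorm univ univ 2 d A :=
        Real.rpow_nonneg (div_nonneg (sum_nonneg fun _ _ => sum_nonneg fun _ _ =>
          prod_nonneg fun _ _ => prod_nonneg fun _ _ => hA _ _) (by positivity)) _
      refine pow_le_pow_left₀ (div_nonneg hnn hδ.le) ?_ _
      rw [← mul_div_mul_right (1 + ε) (1 - ε) hpos.ne']
      exact div_le_div_of_nonneg_right hreg hδ.le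
    _ = _ := pow_mul _ _ _

/-- If `D ≥ -1`, then `(1 + D) ^ d` dominates `-(1 - D) ^ d`. -/
lemma one_add_pow_add_one_sub_pow_nonneg {D : ℝ} (hD : 0 ≤ 1 + D) (d : ℕ) :
    0 ≤ (1 + D) ^ d + (1 + -D) ^ d := by
  rcases le_total D 1 with h | h
  · have : 0 ≤ 1 + -D := by linarith
    positivity
  · have h1 : |1 + -D| ^ d ≤ (1 + D) ^ d :=
      pow_le_pow_left₀ (abs_nonneg _) (abs_le.2 ⟨by linarith, by linarith⟩) d
    rw [← abs_pow] at h1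
    linarith [neg_abs_le ((1 + -D) ^ d)]

lemma two_mul_pow_le {d : ℕ} (hd : 320 ≤ d) :
    2 * (((1 + (1 : ℝ) / 160) / (1 - 1 / 160)) ^ 2) ^ d ≤
      (2 : ℝ) ^ (-((1 : ℝ) / 160 * (d : ℝ) / 2)) * 2 ^ d := by
  have hd' : (320 : ℝ) ≤ d := by exact_mod_cast hd
  have hbase : ((1 + (1 : ℝ) / 160) / (1 - 1 / 160)) ^ 2 ≤ (2 : ℝ) ^ ((1 : ℝ) / 2) := by
    rw [← Real.sqrt_eq_rpow]
    exact Real.le_sqrt_of_sq_le (by norm_num)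
  calc
    _ ≤ 2 * ((2 : ℝ) ^ ((1 : ℝ) / 2)) ^ d := by gcongr
    _ = (2 : ℝ) ^ (1 + (1 : ℝ) / 2 * d) := by
      rw [Real.rpow_add two_pos, Real.rpow_one, Real.rpow_mul two_pos.le, Real.rpow_natCast]
    _ ≤ (2 : ℝ) ^ (-((1 : ℝ) / 160 * (d : ℝ) / 2) + d) :=
      Real.rpow_le_rpow_of_exponent_le one_le_two (by linarith)
    _ = _ := by rw [Real.rpow_add two_pos, Real.rpow_natCast]

/-- **Triangles in regular dense instances.** Let `A ∈ {0,1}^{X×Y}`, `B ∈ {0,1}^{Y×Z}`,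
`C ∈ {0,1}^{X×Z}` on finite nonempty sets, set `ε = 1/160`, and let `d ≥ 320`. If `A` and
`Bᵀ` are `(ε,2,d)`-regular and `ε`-min-degree, `E[A] > 0`, `E[B] > 0`, and
`E[C] > 2^{−εd/2}`, then the tripartite graph contains a triangle. -/
theorem triangle_in_regular_instance {X Y Z : Type*} [Fintype X] [Fintype Y] [Fintype Z]
    [Nonempty X] [Nonempty Y] [Nonempty Z]
    (A : X → Y → ℝ) (B : Y → Z → ℝ) (C : X → Z → ℝ)
    (hA : ZeroOne Finset.univ Finset.univ A) (hB : ZeroOne Finset.univ Finset.univ B)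
    (hC : ZeroOne Finset.univ Finset.univ C)
    (d : ℕ) (hd : 320 ≤ d)
    (hAreg : GridRegular Finset.univ Finset.univ (1/160) 2 d A)
    (hBreg : GridRegular Finset.univ Finset.univ (1/160) 2 d (fun z y => B y z))
    (hAmin : MinDegree Finset.univ Finset.univ (1/160) A)
    (hBmin : MinDegree Finset.univ Finset.univ (1/160) (fun z y => B y z))
    (hAd : 0 < density Finset.univ Finset.univ A)
    (hBd : 0 < density Finset.univ Finset.univ B)
    (hCd : (2 : ℝ) ^ (-((1 : ℝ)/160 * (d : ℝ) / 2)) < density Finset.univ Finset.univ C) :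
    ∃ (x : X) (y : Y) (z : Z), A x y = 1 ∧ B y z = 1 ∧ C x z = 1 := by
  by_contra! hno
  have hd0 : d ≠ 0 := by omega
  have hA0 (x y) : 0 ≤ A x y := by
    rcases hA x (mem_univ x) y (mem_univ y) with h | h <;> simp [h]
  have hB0 (z y) : 0 ≤ B y z := by
    rcases hB y (mem_univ y) z (mem_univ z) with h | h <;> simp [h]
  have hBd' : 0 < density univ univ (fun z y => B y z) := by
    rwa [density_univ_eq_expect, expect_comm, ← density_univ_eq_expect]
  have hε : (1 : ℝ) / 160 < 1 := by norm_num
  have hAdeg := hAmin.rowDeg_pos hε hAd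
  have hBdeg := hBmin.rowDeg_pos hε hBd'
  set f : X → Y → ℝ := fun x y => A x y / rowDeg univ A x - 1
  set g : Z → Y → ℝ := fun z y => B y z / rowDeg univ (fun z y => B y z) z - 1
  set R : ℝ := ((1 + (1 : ℝ) / 160) / (1 - 1 / 160)) ^ 2
  have hAle : 𝔼 x, 𝔼 x', (1 + 𝔼 y, f x y * f x' y) ^ d ≤ R ^ d :=
    hAreg.expect_normalized_le hA0 hε hd0 hAmin hAd
  have hBle : 𝔼 z, 𝔼 z', (1 + 𝔼 y, g z y * g z' y) ^ d ≤ R ^ d :=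
    hBreg.expect_normalized_le hB0 hε hd0 hBmin hBd'
  have hfg (x z) : 1 + 𝔼 y, f x y * g z y = (𝔼 y, A x y * B y z) /
      (rowDeg univ A x * rowDeg univ (fun z y => B y z) z) :=
    one_add_expect_normalized A (fun z y => B y z) (hAdeg x).ne' (hBdeg z).ne'
  have hplus := expect_one_add_correlation_pow_le f g d
  have hminus := expect_one_add_correlation_pow_le f (fun z y => -g z y) d
  simp only [mul_neg, neg_mul, neg_neg, expect_neg_distrib] at hminus
  have hpoint (x z) : C x z * 2 ^ d ≤
      (1 + 𝔼 y, f x y * g z y) ^ d + (1 + -𝔼 y, f x y * g z y) ^ d := by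
    rcases hC x (mem_univ x) z (mem_univ z) with h | h
    · rw [h, zero_mul]
      refine one_add_pow_add_one_sub_pow_nonneg ?_ d
      rw [hfg]
      exact div_nonneg (expect_nonneg fun y _ => mul_nonneg (hA0 x y) (hB0 z y))
        (mul_pos (hAdeg x) (hBdeg z)).le
    · have hzero : 1 + 𝔼 y, f x y * g z y = 0 := by
        have hAB (y : Y) : A x y * B y z = 0 := by
          rcases hA x (mem_univ x) y (mem_univ y) with hA' | hA'
          · rw [hA', zero_mul]
          · rcases hB y (mem_univ y) z (mem_univ z) with hB' | hB'
            · rw [hB', mul_zero]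
            · exact absurd h (hno x y z hA' hB')
        simp [hfg, hAB]
      rw [hzero, show 𝔼 y, f x y * g z y = -1 by linarith, h, zero_pow hd0]
      norm_num
  have hsum : density univ univ C * 2 ^ d ≤ 2 * R ^ d := by
    rw [density_univ_eq_expect]
    simp_rw [expect_mul]
    refine (expect_le_expect fun x _ => expect_le_expect fun z _ => hpoint x z).trans ?_
    simp_rw [expect_add_distrib]
    linarith only [hplus, hminus, hAle, hBle]
  have hlt := mul_lt_mul_of_pos_right hCd (pow_pos (two_pos (α := ℝ)) d)
  exact hlt.not_ge (hsum.trans (two_mul_pow_le hd))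
end

section
/- Let X, Y, Z be finite nonempty sets, let A ∈ {0,1}^{X×Y}, B ∈ {0,1}^{Y×Z} and C ∈ {0,1}^{X×Z}, let α ≥ 0, δ ≥ 0 and ε ∈ [0, 1/2], and assume that the scaled product A∘B is (α,ε,δ)-uniform. Then the number of triples (x,y,z) ∈ X×Y×Z with A(x,y) = B(y,z) = C(x,z) = 1 is at least |X|·|Y|·|Z| · (1−ε)·α · (E[C] − δ). -/
open Finset

/-- The scaled matrix product `(A ∘ B)(x,z) = E_{y∈Y} A(x,y)B(y,z)`. -/
noncomputable def scaledProd {X Y Z : Type*} [Fintype Y] (A : X → Y → ℝ) (B : Y → Z → ℝ) :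
    X → Z → ℝ :=
  fun x z => (∑ y : Y, A x y * B y z) / (Fintype.card Y : ℝ)

open scoped Classical in
/-- `M` is `(α,ε,δ)`-uniform: at least a `(1−δ)`-fraction of the entries lie in
`[(1−ε)α, (1+ε)α]`. -/
def IsUniform {X Z : Type*} [Fintype X] [Fintype Z] (M : X → Z → ℝ) (α ε δ : ℝ) : Prop :=
  (1 - δ) * ((Fintype.card X : ℝ) * (Fintype.card Z : ℝ)) ≤
    ((Finset.univ.filter (fun p : X × Z =>
        (1 - ε) * α ≤ M p.1 p.2 ∧ M p.1 p.2 ≤ (1 + ε) * α)).card : ℝ)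

open scoped Classical in
/-- The number of triangles is the `C`-weighted total of the unscaled matrix product `A B`. -/
theorem card_triangles_eq_sum {X Y Z : Type*} [Fintype X] [Fintype Y] [Fintype Z]
    [Nonempty Y] {A : X → Y → ℝ} {B : Y → Z → ℝ} {C : X → Z → ℝ}
    (hA : ZeroOne Finset.univ Finset.univ A) (hB : ZeroOne Finset.univ Finset.univ B)
    (hC : ZeroOne Finset.univ Finset.univ C) :
    ((Finset.univ.filter (fun p : X × Y × Z =>
        A p.1 p.2.1 = 1 ∧ B p.2.1 p.2.2 = 1 ∧ C p.1 p.2.2 = 1)).card : ℝ)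
      = (Fintype.card Y : ℝ) * ∑ p : X × Z, C p.1 p.2 * scaledProd A B p.1 p.2 := by
  have hY : (Fintype.card Y : ℝ) ≠ 0 := by exact_mod_cast Fintype.card_ne_zero
  have hterm : ∀ x y z, (if A x y = 1 ∧ B y z = 1 ∧ C x z = 1 then (1 : ℝ) else 0)
      = C x z * (A x y * B y z) := by
    intro x y z
    rcases hA x (mem_univ _) y (mem_univ _) with h | h <;>
      rcases hB y (mem_univ _) z (mem_univ _) with h' | h' <;>
      rcases hC x (mem_univ _) z (mem_univ _) with h'' | h'' <;> simp [h, h', h'']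
  rw [← Finset.sum_boole, Fintype.sum_prod_type, Fintype.sum_prod_type, Finset.mul_sum]
  refine Finset.sum_congr rfl fun x _ => ?_
  simp only [Fintype.sum_prod_type, hterm]
  rw [Finset.sum_comm, Finset.mul_sum]
  refine Finset.sum_congr rfl fun z _ => ?_
  rw [← Finset.mul_sum, scaledProd]
  field_simp

/-- A zero-one matrix `C` of density `E[C]` has weighted total at least
`(1-ε)α(E[C]-δ)·|X||Z|` against a nonnegative `(α,ε,δ)`-uniform matrix. -/
theorem IsUniform.le_sum_mul {X Z : Type*} [Fintype X] [Fintype Z] [Nonempty X] [Nonempty Z]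
    {M C : X → Z → ℝ} {α ε δ : ℝ} (hM : ∀ x z, 0 ≤ M x z)
    (hC : ZeroOne Finset.univ Finset.univ C) (ha : 0 ≤ (1 - ε) * α) (h : IsUniform M α ε δ) :
    (Fintype.card X : ℝ) * (Fintype.card Z : ℝ) * ((1 - ε) * α)
        * (density Finset.univ Finset.univ C - δ)
      ≤ ∑ p : X × Z, C p.1 p.2 * M p.1 p.2 := by
  classical
  have hX : (Fintype.card X : ℝ) ≠ 0 := by exact_mod_cast Fintype.card_ne_zero
  have hZ : (Fintype.card Z : ℝ) ≠ 0 := by exact_mod_cast Fintype.card_ne_zero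
  have hpoint : ∀ p : X × Z, (1 - ε) * α * (C p.1 p.2
      + (if (1 - ε) * α ≤ M p.1 p.2 ∧ M p.1 p.2 ≤ (1 + ε) * α then 1 else 0) - 1)
      ≤ C p.1 p.2 * M p.1 p.2 := by
    rintro ⟨x, z⟩
    have := hM x z
    rcases hC x (mem_univ _) z (mem_univ _) with hc | hc <;> split_ifs with hg
    all_goals simp only [hc]; linarith
  have hdens : (Fintype.card X : ℝ) * Fintype.card Z * density Finset.univ Finset.univ C
      = ∑ p : X × Z, C p.1 p.2 := by
    rw [density, Fintype.sum_prod_type, Finset.card_univ, Finset.card_univ]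
    field_simp
  have hsum := Finset.sum_le_sum fun p (_ : p ∈ Finset.univ) => hpoint p
  rw [← Finset.mul_sum, Finset.sum_sub_distrib, Finset.sum_add_distrib, Finset.sum_boole,
    ← hdens] at hsum
  simp only [Finset.sum_const, Finset.card_univ, Fintype.card_prod, nsmul_eq_mul, mul_one,
    Nat.cast_mul] at hsum
  refine le_trans ?_ hsum
  rw [mul_comm _ ((1 - ε) * α), mul_assoc]
  refine mul_le_mul_of_nonneg_left ?_ ha
  unfold IsUniform at h
  linarith

open scoped Classical in
/-- **Triangle counting from a uniform product.** If the scaled product `A ∘ B` is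
`(α,ε,δ)`-uniform with `α, δ ≥ 0` and `ε ∈ [0,1/2]`, then the number of triangles
`(x,y,z)` with `A(x,y) = B(y,z) = C(x,z) = 1` is at least
`|X||Y||Z|·(1−ε)·α·(E[C] − δ)`. -/
theorem triangle_count_from_uniformity {X Y Z : Type*} [Fintype X] [Fintype Y] [Fintype Z]
    [Nonempty X] [Nonempty Y] [Nonempty Z]
    (A : X → Y → ℝ) (B : Y → Z → ℝ) (C : X → Z → ℝ)
    (hA : ZeroOne Finset.univ Finset.univ A) (hB : ZeroOne Finset.univ Finset.univ B)
    (hC : ZeroOne Finset.univ Finset.univ C)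
    (α δ ε : ℝ) (hα : 0 ≤ α) (hδ : 0 ≤ δ) (hε : ε ∈ Set.Icc (0 : ℝ) (1/2))
    (hunif : IsUniform (scaledProd A B) α ε δ) :
    (Fintype.card X : ℝ) * (Fintype.card Y : ℝ) * (Fintype.card Z : ℝ)
        * ((1 - ε) * α) * (density Finset.univ Finset.univ C - δ)
      ≤ ((Finset.univ.filter (fun p : X × Y × Z =>
            A p.1 p.2.1 = 1 ∧ B p.2.1 p.2.2 = 1 ∧ C p.1 p.2.2 = 1)).card : ℝ) := by
  have hM : ∀ x z, 0 ≤ scaledProd A B x z := fun x z => by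
    refine div_nonneg (Finset.sum_nonneg fun y _ => mul_nonneg ?_ ?_) (Nat.cast_nonneg _)
    · rcases hA x (mem_univ _) y (mem_univ _) with h | h <;> simp [h]
    · rcases hB y (mem_univ _) z (mem_univ _) with h | h <;> simp [h]
  have ha : 0 ≤ (1 - ε) * α := mul_nonneg (by linarith [hε.2]) hα
  rw [card_triangles_eq_sum hA hB hC]
  calc _ = (Fintype.card Y : ℝ) * ((Fintype.card X : ℝ) * (Fintype.card Z : ℝ)
        * ((1 - ε) * α) * (density Finset.univ Finset.univ C - δ)) := by ring
    _ ≤ _ := mul_le_mul_of_nonneg_left (hunif.le_sum_mul hM hC ha) (Nat.cast_nonneg _)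
end
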